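/- Let X, Y ⊂ ℝⁿ be bounded open sets and b : X̄ × Ȳ → ℝ smooth satisfying B1, B2, B3, with Y(x,p) the inverse of y ↦ b_x(x,y). Fix x₀ ∈ X̄ and y₀, y₁ ∈ Ȳ, and for t ∈ [0,1] let y_t := Y( x₀, (1−t) b_x(x₀,y₀) + t b_x(x₀,y₁) ) (which is well defined by B1 and B2). Then for every x ∈ X̄ the function t ↦ b(x, y_t) − b(x₀, y_t) is convex on [0,1]; in particular, for all t ∈ [0,1], b(x,y_t) − b(x₀,y_t) ≤ max{ b(x,y₀) − b(x₀,y₀), b(x,y₁) − b(x₀,y₁) }. -/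

import Mathlib

open MeasureTheory RealInnerProductSpace

noncomputable section

variable {n : ℕ}

/-- The differential `b_x(x,y)` of the benefit `b` in the `x` variable, as a vector. -/
def bX (b : EuclideanSpace ℝ (Fin n) → EuclideanSpace ℝ (Fin n) → ℝ)
    (x y : EuclideanSpace ℝ (Fin n)) : EuclideanSpace ℝ (Fin n) :=
  gradient (fun x' => b x' y) x

/-- The differential `b_y(x,y)` of the benefit `b` in the `y` variable, as a vector. -/
def bYd (b : EuclideanSpace ℝ (Fin n) → EuclideanSpace ℝ (Fin n) → ℝ)
    (x y : EuclideanSpace ℝ (Fin n)) : EuclideanSpace ℝ (Fin n) :=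
  gradient (fun y' => b x y') y

/-- The Hessian `D²_{xx} b(x,y)` in the `x` variable, as a continuous linear map. -/
def Hxx (b : EuclideanSpace ℝ (Fin n) → EuclideanSpace ℝ (Fin n) → ℝ)
    (x y : EuclideanSpace ℝ (Fin n)) :
    EuclideanSpace ℝ (Fin n) →L[ℝ] EuclideanSpace ℝ (Fin n) :=
  fderiv ℝ (fun x' => bX b x' y) x

/-- `f` is a (smooth) diffeomorphism of `s` onto its range: it is smooth on `s`,
and admits an inverse on `s` which is smooth on `f '' s`. -/
def IsDiffeoOnto (f : EuclideanSpace ℝ (Fin n) → EuclideanSpace ℝ (Fin n))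
    (s : Set (EuclideanSpace ℝ (Fin n))) : Prop :=
  ContDiffOn ℝ (⊤ : ℕ∞) f s ∧ ∃ g, Set.LeftInvOn g f s ∧ ContDiffOn ℝ (⊤ : ℕ∞) g (f '' s)

/-- Condition B1: `y ↦ b_x(x₀,y)` and `x ↦ b_y(x,y₀)` are diffeomorphisms onto
their ranges. -/
def CondB1 (b : EuclideanSpace ℝ (Fin n) → EuclideanSpace ℝ (Fin n) → ℝ)
    (X Y : Set (EuclideanSpace ℝ (Fin n))) : Prop :=
  (∀ x₀ ∈ closure X, IsDiffeoOnto (fun y => bX b x₀ y) (closure Y)) ∧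
  (∀ y₀ ∈ closure Y, IsDiffeoOnto (fun x => bYd b x y₀) (closure X))

/-- Condition B2: the sets `b_x(x₀, Ȳ)` and `b_y(X̄, y₀)` are convex. -/
def CondB2 (b : EuclideanSpace ℝ (Fin n) → EuclideanSpace ℝ (Fin n) → ℝ)
    (X Y : Set (EuclideanSpace ℝ (Fin n))) : Prop :=
  (∀ x₀ ∈ closure X, Convex ℝ ((fun y => bX b x₀ y) '' closure Y)) ∧
  (∀ y₀ ∈ closure Y, Convex ℝ ((fun x => bYd b x y₀) '' closure X))

/-- `Ymap` is the inverse of `y ↦ b_x(x,y)`: `Y(x, b_x(x,y)) = y` on `Ȳ`, and for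
`p ∈ b_x(x,Ȳ)`, `Y(x,p) ∈ Ȳ` with `b_x(x, Y(x,p)) = p`. -/
def IsYmap (b : EuclideanSpace ℝ (Fin n) → EuclideanSpace ℝ (Fin n) → ℝ)
    (X Y : Set (EuclideanSpace ℝ (Fin n)))
    (Ymap : EuclideanSpace ℝ (Fin n) → EuclideanSpace ℝ (Fin n) → EuclideanSpace ℝ (Fin n)) :
    Prop :=
  ∀ x ∈ closure X, (∀ y ∈ closure Y, Ymap x (bX b x y) = y) ∧
    ∀ p ∈ (fun y => bX b x y) '' closure Y, Ymap x p ∈ closure Y ∧ bX b x (Ymap x p) = p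

/-- Condition B3: for every `x ∈ X̄` and direction `ξ`, the function
`p ↦ ⟨ξ, D²_{xx} b(x, Y(x,p)) ξ⟩` is convex on `b_x(x, Ȳ)`. -/
def CondB3 (b : EuclideanSpace ℝ (Fin n) → EuclideanSpace ℝ (Fin n) → ℝ)
    (X Y : Set (EuclideanSpace ℝ (Fin n)))
    (Ymap : EuclideanSpace ℝ (Fin n) → EuclideanSpace ℝ (Fin n) → EuclideanSpace ℝ (Fin n)) :
    Prop :=
  ∀ x ∈ closure X, ∀ ξ : EuclideanSpace ℝ (Fin n),
    ConvexOn ℝ ((fun y => bX b x y) '' closure Y) (fun p => ⟪ξ, Hxx b x (Ymap x p) ξ⟫)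

/-- `u` is `b`-convex on `X`: it is a supremum of `b`-affine functions. -/
def BConvexOn (b : EuclideanSpace ℝ (Fin n) → EuclideanSpace ℝ (Fin n) → ℝ)
    (X Y : Set (EuclideanSpace ℝ (Fin n))) (u : EuclideanSpace ℝ (Fin n) → ℝ) : Prop :=
  ∃ v : EuclideanSpace ℝ (Fin n) → ℝ,
    ∀ x ∈ X, u x = sSup ((fun y => b x y - v y) '' closure Y)


open Filter Topology ContDiff Set

section DirectionalDerivative

variable {V : Type*} [NormedAddCommGroup V] [NormedSpace ℝ V]

/-- The derivative of `F` at `z` in the direction `u`. -/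
def dirDeriv (F : V → ℝ) (u z : V) : ℝ := fderiv ℝ F z u

variable {F : V → ℝ} {U : Set V}

lemma ContDiffOn.dirDeriv (hF : ContDiffOn ℝ ∞ F U) (hU : IsOpen U) (u : V) :
    ContDiffOn ℝ ∞ (dirDeriv F u) U :=
  (hF.fderiv_of_isOpen hU (m := ∞) (by simp)).clm_apply contDiffOn_const

lemma dirDeriv_congr {G : V → ℝ} (hU : IsOpen U) (h : EqOn F G U) (u : V) :
    EqOn (dirDeriv F u) (dirDeriv G u) U := fun z hz => by
  have : F =ᶠ[𝓝 z] G := eventually_of_mem (hU.mem_nhds hz) h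
  simp only [dirDeriv, this.fderiv_eq]

lemma differentiableAt_fderiv_of_contDiffOn (hF : ContDiffOn ℝ ∞ F U) (hU : IsOpen U) {z : V}
    (hz : z ∈ U) : DifferentiableAt ℝ (fderiv ℝ F) z :=
  ((hF.fderiv_of_isOpen hU (m := ∞) (by simp)).contDiffAt (hU.mem_nhds hz)).differentiableAt
    (by simp)

lemma dirDeriv_dirDeriv (hF : ContDiffOn ℝ ∞ F U) (hU : IsOpen U) (u v : V) {z : V} (hz : z ∈ U) :
    dirDeriv (dirDeriv F u) v z = fderiv ℝ (fderiv ℝ F) z v u := by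
  have := ((differentiableAt_fderiv_of_contDiffOn hF hU hz).hasFDerivAt.clm_apply
    (hasFDerivAt_const u z)).fderiv
  change fderiv ℝ (fun y => fderiv ℝ F y u) z v = _
  rw [this]
  simp

lemma dirDeriv_comm (hF : ContDiffOn ℝ ∞ F U) (hU : IsOpen U) (u v : V) :
    EqOn (dirDeriv (dirDeriv F u) v) (dirDeriv (dirDeriv F v) u) U := fun z hz => by
  rw [dirDeriv_dirDeriv hF hU u v hz, dirDeriv_dirDeriv hF hU v u hz]
  refine ((hF.contDiffAt (hU.mem_nhds hz)).isSymmSndFDerivAt ?_).eq v u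
  rw [minSmoothness_of_isRCLikeNormedField]
  exact WithTop.coe_le_coe.2 le_top

lemma hasDerivAt_comp_dirDeriv (hF : ContDiffOn ℝ ∞ F U) (hU : IsOpen U) {c : ℝ → V} {c' : V}
    {t : ℝ} (hc : HasDerivAt c c' t) (ht : c t ∈ U) :
    HasDerivAt (fun r => F (c r)) (dirDeriv F c' (c t)) t :=
  ((hF.contDiffAt (hU.mem_nhds ht)).differentiableAt (by simp)).hasFDerivAt.comp_hasDerivAt t hc

lemma deriv_deriv_comp (hF : ContDiffOn ℝ ∞ F U) (hU : IsOpen U) {c : ℝ → V} {t : ℝ}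
    (hc : ContDiffAt ℝ ∞ c t) (ht : c t ∈ U) :
    deriv (deriv fun r => F (c r)) t =
      dirDeriv (dirDeriv F (deriv c t)) (deriv c t) (c t) + dirDeriv F (deriv (deriv c) t) (c t) := by
  have hev : ∀ᶠ r in 𝓝 t, deriv (fun r => F (c r)) r = fderiv ℝ F (c r) (deriv c r) := by
    have h1 : ∀ᶠ r in 𝓝 t, ContDiffAt ℝ 1 c r :=
      (hc.of_le (by norm_cast)).eventually (by simp)
    filter_upwards [h1, hc.continuousAt.preimage_mem_nhds (hU.mem_nhds ht)] with r hr hrU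
    exact (hasDerivAt_comp_dirDeriv hF hU (hr.differentiableAt (by simp)).hasDerivAt hrU).deriv
  rw [EventuallyEq.deriv_eq hev]
  have hd := differentiableAt_fderiv_of_contDiffOn hF hU ht
  have hc1 : HasDerivAt c (deriv c t) t := (hc.differentiableAt (by simp)).hasDerivAt
  have hc2 : HasDerivAt (deriv c) (deriv (deriv c) t) t := by
    have : ContDiffAt ℝ ∞ (deriv c) t :=
      (hc.fderiv_right (m := ∞) (by simp)).clm_apply contDiffAt_const
    exact (this.differentiableAt (by simp)).hasDerivAt
  have h3 := (hd.hasFDerivAt.comp_hasDerivAt t hc1).clm_apply hc2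
  rw [dirDeriv_dirDeriv hF hU _ _ ht]
  exact h3.deriv

end DirectionalDerivative

section Diffeo

lemma leftInvOn_symm {α β : Type*} {f : α → β} {g : β → α} {s : Set α} (h : LeftInvOn g f s) :
    LeftInvOn f g (f '' s) := by
  rintro _ ⟨x, hx, rfl⟩
  rw [h hx]

variable {E : Type*} [NormedAddCommGroup E] [NormedSpace ℝ E] [FiniteDimensional ℝ E]
  {f g : E → E} {s : Set E}

lemma image_mem_nhds_of_leftInvOn (hf : ContDiffOn ℝ ∞ f s) (hg : ContDiffOn ℝ ∞ g (f '' s))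
    (h : LeftInvOn g f s) {x : E} (hx : s ∈ 𝓝 x) : f '' s ∈ 𝓝 (f x) := by
  have hxs := mem_of_mem_nhds hx
  have hF := (hf.contDiffAt hx).hasStrictFDerivAt (by simp)
  have hG := ((hg _ (mem_image_of_mem f hxs)).differentiableWithinAt (by simp)).hasFDerivWithinAt
  have hcomp := hG.comp x (hF.hasFDerivAt.hasFDerivWithinAt (s := s)) (mapsTo_image f s)
  have hid : HasFDerivAt (g ∘ f) (ContinuousLinearMap.id ℝ E) x :=
    (hasFDerivAt_id x).congr_of_eventuallyEq (eventually_of_mem hx h)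
  have heq := (hcomp.hasFDerivAt hx).unique hid
  have hinj : Function.Injective (fderiv ℝ f x) := by
    refine Function.LeftInverse.injective (g := fderivWithin ℝ g (f '' s) (f x)) fun v => ?_
    simpa using DFunLike.congr_fun heq v
  have hsurj : Function.Surjective (fderiv ℝ f x) :=
    (LinearMap.injective_iff_surjective (f := (fderiv ℝ f x : E →ₗ[ℝ] E))).1 hinj
  rw [← hF.map_nhds_eq_of_surj (LinearMap.range_eq_top.2 hsurj)]
  exact image_mem_map hx

lemma mem_nhds_of_leftInvOn (hf : ContDiffOn ℝ ∞ f s) (hg : ContDiffOn ℝ ∞ g (f '' s))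
    (h : LeftInvOn g f s) {p : E} (hp : f '' s ∈ 𝓝 p) : s ∈ 𝓝 (g p) := by
  have := image_mem_nhds_of_leftInvOn hg (by rwa [h.image_image]) (leftInvOn_symm h) hp
  rwa [h.image_image] at this

lemma uniqueDiffOn_of_leftInvOn (hf : ContDiffOn ℝ ∞ f s) (hg : ContDiffOn ℝ ∞ g (f '' s))
    (h : LeftInvOn g f s) (hconv : Convex ℝ (f '' s)) (hs : (interior s).Nonempty) :
    UniqueDiffOn ℝ s := by
  obtain ⟨x₀, hx₀⟩ := hs
  have hC : UniqueDiffOn ℝ (f '' s) := uniqueDiffOn_convex hconv ⟨f x₀, mem_interior_iff_mem_nhds.2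
    (image_mem_nhds_of_leftInvOn hf hg h (mem_interior_iff_mem_nhds.1 hx₀))⟩
  intro x hx
  have hfx := mem_image_of_mem f hx
  have hG := ((hg _ hfx).differentiableWithinAt (by simp)).hasFDerivWithinAt
  have hF := ((hf x hx).differentiableWithinAt (by simp)).hasFDerivWithinAt
  rw [← h hx] at hF
  have hmaps : MapsTo g (f '' s) s := by
    rintro _ ⟨z, hz, rfl⟩
    rwa [h hz]
  have hcomp := hF.comp (f x) hG hmaps
  have hid : HasFDerivWithinAt (f ∘ g) (ContinuousLinearMap.id ℝ E) (f '' s) (f x) :=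
    (hasFDerivWithinAt_id _ _).congr (fun p hp => leftInvOn_symm h hp) (leftInvOn_symm h hfx)
  have heq := (hC _ hfx).eq hcomp hid
  have hinj : Function.Injective (fderivWithin ℝ g (f '' s) (f x)) := by
    refine Function.LeftInverse.injective (g := fderivWithin ℝ f s (g (f x))) fun v => ?_
    simpa using DFunLike.congr_fun heq v
  have hsurj : Function.Surjective (fderivWithin ℝ g (f '' s) (f x)) :=
    (LinearMap.injective_iff_surjective
      (f := (fderivWithin ℝ g (f '' s) (f x) : E →ₗ[ℝ] E))).1 hinj
  have := hG.uniqueDiffWithinAt (hC _ hfx) hsurj.denseRange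
  rwa [h.image_image, h hx] at this

end Diffeo

section CrossCurvature

variable {E : Type*} [NormedAddCommGroup E] [NormedSpace ℝ E]
  {F K : ℝ × E → ℝ} {U : Set (ℝ × E)}

lemma deriv_deriv_comp_snd (hF : ContDiffOn ℝ ∞ F U) (hU : IsOpen U) {c : ℝ → E} {s t : ℝ}
    (hc : ContDiffAt ℝ ∞ c t) (ht : (s, c t) ∈ U) :
    deriv (deriv fun r => F (s, c r)) t =
      dirDeriv (dirDeriv F (0, deriv c t)) (0, deriv c t) (s, c t) +
        dirDeriv F (0, deriv (deriv c) t) (s, c t) := by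
  have hev : deriv (fun r => (s, c r)) =ᶠ[𝓝 t] fun r => ((0 : ℝ), deriv c r) := by
    have h1 : ∀ᶠ r in 𝓝 t, ContDiffAt ℝ 1 c r := (hc.of_le (by norm_cast)).eventually (by simp)
    filter_upwards [h1] with r hr
    exact ((hasDerivAt_const r s).prodMk (hr.differentiableAt (by simp)).hasDerivAt).deriv
  have hc' : ContDiffAt ℝ ∞ (deriv c) t :=
    (hc.fderiv_right (m := ∞) (by simp)).clm_apply contDiffAt_const
  have h2 : deriv (deriv fun r => (s, c r)) t = (0, deriv (deriv c) t) := by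
    rw [hev.deriv_eq]
    exact ((hasDerivAt_const t (0 : ℝ)).prodMk
      (hc'.differentiableAt (by simp)).hasDerivAt).deriv
  rw [deriv_deriv_comp hF hU (contDiffAt_const.prodMk hc) ht, h2, hev.eq_of_nhds]

lemma hasDerivAt_comp_fst (hF : ContDiffOn ℝ ∞ F U) (hU : IsOpen U) {y : E} {s : ℝ}
    (hs : (s, y) ∈ U) : HasDerivAt (fun r => F (r, y)) (dirDeriv F (1, 0) (s, y)) s :=
  hasDerivAt_comp_dirDeriv hF hU ((hasDerivAt_id s).prodMk (hasDerivAt_const s y)) hs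

lemma dirDeriv_second_order_comm (hK : ContDiffOn ℝ ∞ K U) (hU : IsOpen U) (e v w : ℝ × E) :
    EqOn (dirDeriv (fun z => dirDeriv (dirDeriv K v) v z + dirDeriv K w z) e)
      (fun z => dirDeriv (dirDeriv (dirDeriv K e) v) v z + dirDeriv (dirDeriv K e) w z) U := by
  intro z hz
  have hd : ∀ {F : ℝ × E → ℝ}, ContDiffOn ℝ ∞ F U → DifferentiableAt ℝ F z := fun hF =>
    (hF.contDiffAt (hU.mem_nhds hz)).differentiableAt (by simp)
  have hadd := ((hd ((hK.dirDeriv hU v).dirDeriv hU v)).hasFDerivAt.add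
    (hd (hK.dirDeriv hU w)).hasFDerivAt).fderiv
  have hvv : dirDeriv (dirDeriv (dirDeriv K v) v) e z = dirDeriv (dirDeriv (dirDeriv K e) v) v z := by
    rw [dirDeriv_comm (hK.dirDeriv hU v) hU v e hz,
      dirDeriv_congr hU (dirDeriv_comm hK hU v e) v hz]
  calc _ = dirDeriv (dirDeriv (dirDeriv K v) v) e z + dirDeriv (dirDeriv K w) e z :=
        DFunLike.congr_fun hadd e
    _ = _ := by rw [hvv, dirDeriv_comm hK hU w e hz]

/-- If along the segment `[0, 1] × {y t₀}` the mixed derivative `∂²ₛ∂²ₜ K` is nonnegative, measured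
along curves that may depend on `s` (which is harmless as `∂_y K` is affine in `s`), and
`∂ₛ∂²ₜ K` vanishes at `s = 0`, then `∂²ₜ K` increases from `s = 0` to `s = 1`. -/
lemma deriv_deriv_le_of_cross_curvature (hK : ContDiffOn ℝ ∞ K U) (hU : IsOpen U) {y : ℝ → E}
    {t₀ : ℝ} (hy : ContDiffAt ℝ ∞ y t₀) (hmem : ∀ s ∈ Icc (0 : ℝ) 1, (s, y t₀) ∈ U)
    (hzero : deriv (deriv fun t => dirDeriv K (1, 0) (0, y t)) t₀ = 0)
    (hcurv : ∀ s ∈ Ioo (0 : ℝ) 1, ∃ c : ℝ → E, ContDiffAt ℝ ∞ c 0 ∧ c 0 = y t₀ ∧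
      deriv c 0 = deriv y t₀ ∧
      0 ≤ deriv (deriv fun r => dirDeriv (dirDeriv K (1, 0)) (1, 0) (s, c r)) 0)
    (haffine : ∀ w : E, ∃ α β : ℝ, ∀ s ∈ Ioo (0 : ℝ) 1,
      dirDeriv K (0, w) (s, y t₀) = α + s * β) :
    deriv (deriv fun t => K (0, y t)) t₀ ≤ deriv (deriv fun t => K (1, y t)) t₀ := by
  set e : ℝ × E := (1, 0) with he
  set v : ℝ × E := (0, deriv y t₀) with hv
  set w : ℝ × E := (0, deriv (deriv y) t₀) with hw
  have hKe := hK.dirDeriv hU e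
  have hKee := hKe.dirDeriv hU e
  set G : ℝ × E → ℝ := fun z => dirDeriv (dirDeriv K v) v z + dirDeriv K w z with hG
  have hGs : ContDiffOn ℝ ∞ G U :=
    ((hK.dirDeriv hU v).dirDeriv hU v).add (hK.dirDeriv hU w)
  have hG1 := dirDeriv_second_order_comm hK hU e v w
  have hG2 : EqOn (dirDeriv (dirDeriv G e) e) (fun z =>
      dirDeriv (dirDeriv (dirDeriv (dirDeriv K e) e) v) v z +
        dirDeriv (dirDeriv (dirDeriv K e) e) w z) U := fun z hz => by
    rw [dirDeriv_congr hU hG1 e hz, dirDeriv_second_order_comm hKe hU e v w hz]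
  have hvanish : ∀ u : E, ∀ s ∈ Ioo (0 : ℝ) 1,
      dirDeriv (dirDeriv (dirDeriv K e) e) (0, u) (s, y t₀) = 0 := by
    intro u s hs
    have hsU := hmem s (Ioo_subset_Icc_self hs)
    obtain ⟨α, β, hαβ⟩ := haffine u
    have hKu := hK.dirDeriv hU (0, u)
    rw [dirDeriv_comm hKe hU e (0, u) hsU, dirDeriv_congr hU (dirDeriv_comm hK hU e (0, u)) e hsU]
    have h1 : ∀ r ∈ Ioo (0 : ℝ) 1, dirDeriv (dirDeriv K (0, u)) e (r, y t₀) = β := by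
      intro r hr
      have h := hasDerivAt_comp_fst hKu hU (hmem r (Ioo_subset_Icc_self hr))
      have h' : HasDerivAt (fun r : ℝ => α + r * β) β r := by
        simpa using ((hasDerivAt_id r).mul_const β).const_add α
      exact h.unique (h'.congr_of_eventuallyEq
        (eventually_of_mem (isOpen_Ioo.mem_nhds hr) hαβ))
    exact (hasDerivAt_comp_fst (hKu.dirDeriv hU e) hU hsU).unique
      ((hasDerivAt_const s β).congr_of_eventuallyEq
        (eventually_of_mem (isOpen_Ioo.mem_nhds hs) h1))
  have hnonneg : ∀ s ∈ Ioo (0 : ℝ) 1, 0 ≤ dirDeriv (dirDeriv G e) e (s, y t₀) := by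
    intro s hs
    have hsU := hmem s (Ioo_subset_Icc_self hs)
    obtain ⟨c, hc, hc0, hc1, hpos⟩ := hcurv s hs
    rw [deriv_deriv_comp_snd hKee hU hc (by rwa [hc0]), hc0, hc1, hvanish _ s hs] at hpos
    rw [hG2 hsU]
    simp only
    rw [hw, hvanish _ s hs]
    exact hpos
  have hd0 : ∀ s ∈ Icc (0 : ℝ) 1, HasDerivAt (fun r => G (r, y t₀)) (dirDeriv G e (s, y t₀)) s :=
    fun s hs => hasDerivAt_comp_fst hGs hU (hmem s hs)
  have hd1 : ∀ s ∈ Icc (0 : ℝ) 1,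
      HasDerivAt (fun r => dirDeriv G e (r, y t₀)) (dirDeriv (dirDeriv G e) e (s, y t₀)) s :=
    fun s hs => hasDerivAt_comp_fst (hGs.dirDeriv hU e) hU (hmem s hs)
  have hmono1 : MonotoneOn (fun r => dirDeriv G e (r, y t₀)) (Icc 0 1) := by
    refine monotoneOn_of_deriv_nonneg (convex_Icc 0 1)
      (fun s hs => (hd1 s hs).continuousAt.continuousWithinAt) (fun s hs => ?_) (fun s hs => ?_)
    · exact (hd1 s (interior_subset hs)).differentiableAt.differentiableWithinAt
    · rw [(hd1 s (interior_subset hs)).deriv]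
      exact hnonneg s (by rwa [interior_Icc] at hs)
  have hstart : dirDeriv G e (0, y t₀) = 0 := by
    rw [deriv_deriv_comp_snd hKe hU hy (hmem 0 (by simp))] at hzero
    rw [hG1 (hmem 0 (by simp))]
    exact hzero
  have hmono0 : MonotoneOn (fun r => G (r, y t₀)) (Icc 0 1) := by
    refine monotoneOn_of_deriv_nonneg (convex_Icc 0 1)
      (fun s hs => (hd0 s hs).continuousAt.continuousWithinAt) (fun s hs => ?_) (fun s hs => ?_)
    · exact (hd0 s (interior_subset hs)).differentiableAt.differentiableWithinAt
    · have hs' : s ∈ Icc (0 : ℝ) 1 := interior_subset hs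
      rw [(hd0 s hs').deriv, ← hstart]
      exact hmono1 (by simp) hs' hs'.1
  rw [deriv_deriv_comp_snd hK hU hy (hmem 0 (by simp)),
    deriv_deriv_comp_snd hK hU hy (hmem 1 (by simp))]
  exact hmono0 (by simp) (by simp) zero_le_one

end CrossCurvature

lemma deriv_deriv_nonneg_of_convexOn {φ : ℝ → ℝ} {s : Set ℝ} {t : ℝ} (hs : s ∈ 𝓝 t)
    (hφ : ConvexOn ℝ s φ) (hc : ContDiffAt ℝ ∞ φ t) : 0 ≤ deriv (deriv φ) t := by
  have h1 : ∀ᶠ r in 𝓝 t, ContDiffAt ℝ 1 φ r := (hc.of_le (by norm_cast)).eventually (by simp)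
  obtain ⟨ε, hε, hball⟩ := Metric.mem_nhds_iff.1 (inter_mem hs h1)
  have hmono : MonotoneOn (deriv φ) (Metric.ball t ε) :=
    (hφ.subset (fun r hr => (hball hr).1) (convex_ball t ε)).monotoneOn_deriv
      fun r hr => ContDiffAt.differentiableAt (n := 1) (hball hr).2 one_ne_zero
  have := hmono.derivWithin_nonneg (x := t)
  rwa [derivWithin_of_isOpen Metric.isOpen_ball (Metric.mem_ball_self hε)] at this

section Gradient

variable {F : Type*} [NormedAddCommGroup F] [InnerProductSpace ℝ F] [CompleteSpace F]

lemma ContDiffAt.gradient {f : F → ℝ} {x : F} (hf : ContDiffAt ℝ ∞ f x) :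
    ContDiffAt ℝ ∞ (gradient f) x := by
  have h := hf.fderiv_right (m := ∞) (by simp)
  exact ((InnerProductSpace.toDual ℝ F).symm.toLinearIsometry.toContinuousLinearMap :
    (F →L[ℝ] ℝ) →L[ℝ] F).contDiff.contDiffAt.comp x h

lemma gradient_eq_of_hasFDerivWithinAt {f : F → ℝ} {s : Set F} {x : F}
    {f' : F →L[ℝ] ℝ} (hf : DifferentiableAt ℝ f x) (h : HasFDerivWithinAt f f' s x)
    (hs : UniqueDiffWithinAt ℝ s x) :
    gradient f x = (InnerProductSpace.toDual ℝ F).symm f' := by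
  rw [gradient, hs.eq hf.hasFDerivAt.hasFDerivWithinAt h]

end Gradient

variable {X Y : Set (EuclideanSpace ℝ (Fin n))}
  {b : EuclideanSpace ℝ (Fin n) → EuclideanSpace ℝ (Fin n) → ℝ}
  {Ymap : EuclideanSpace ℝ (Fin n) → EuclideanSpace ℝ (Fin n) → EuclideanSpace ℝ (Fin n)}

lemma IsYmap.leftInvOn (hY : IsYmap b X Y Ymap) {x : EuclideanSpace ℝ (Fin n)}
    (hx : x ∈ closure X) : LeftInvOn (Ymap x) (bX b x) (closure Y) := (hY x hx).1

lemma IsYmap.contDiffOn (hY : IsYmap b X Y Ymap) (hB1 : CondB1 b X Y)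
    {x : EuclideanSpace ℝ (Fin n)} (hx : x ∈ closure X) :
    ContDiffOn ℝ ∞ (Ymap x) (bX b x '' closure Y) := by
  obtain ⟨-, g, hg, hgs⟩ := hB1.1 x hx
  refine hgs.congr ?_
  rintro _ ⟨y, hy, rfl⟩
  rw [hY.leftInvOn hx hy]
  exact (hg hy).symm

lemma contDiffAt_uncurry_of_mem_nhds
    (hb : ContDiffOn ℝ ∞ (Function.uncurry b) (closure X ×ˢ closure Y))
    {x y : EuclideanSpace ℝ (Fin n)} (hx : closure X ∈ 𝓝 x) (hy : closure Y ∈ 𝓝 y) :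
    ContDiffAt ℝ ∞ (Function.uncurry b) (x, y) :=
  hb.contDiffAt (prod_mem_nhds hx hy)

lemma contDiffAt_left_of_mem_nhds
    (hb : ContDiffOn ℝ ∞ (Function.uncurry b) (closure X ×ˢ closure Y))
    {x y : EuclideanSpace ℝ (Fin n)} (hx : closure X ∈ 𝓝 x) (hy : closure Y ∈ 𝓝 y) :
    ContDiffAt ℝ ∞ (fun x' => b x' y) x :=
  ContDiffAt.comp (f := fun x' => (x', y)) x (contDiffAt_uncurry_of_mem_nhds hb hx hy)
    (contDiffAt_id.prodMk contDiffAt_const)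

lemma contDiffAt_right_of_mem_nhds
    (hb : ContDiffOn ℝ ∞ (Function.uncurry b) (closure X ×ˢ closure Y))
    {x y : EuclideanSpace ℝ (Fin n)} (hx : closure X ∈ 𝓝 x) (hy : closure Y ∈ 𝓝 y) :
    ContDiffAt ℝ ∞ (fun y' => b x y') y :=
  ContDiffAt.comp (f := fun y' => (x, y')) y (contDiffAt_uncurry_of_mem_nhds hb hx hy)
    (contDiffAt_const.prodMk contDiffAt_id)

lemma deriv_deriv_inner_affine {F : Type*} [NormedAddCommGroup F] [InnerProductSpace ℝ F]
    (a d u : F) (t : ℝ) : deriv (deriv fun r : ℝ => ⟪a + r • d, u⟫) t = 0 := by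
  have : (deriv fun r : ℝ => ⟪a + r • d, u⟫) = fun _ => ⟪d, u⟫ := by
    funext r
    have h : (fun r : ℝ => ⟪a + r • d, u⟫) = fun r : ℝ => ⟪a, u⟫ + r * ⟪d, u⟫ := by
      funext r
      rw [inner_add_left, real_inner_smul_left]
    rw [h]
    simp
  rw [this]
  simp

/-- At a point `ȳ` of a `b*`-segment with respect to `x₀`, the second derivative of `b(x, ·)` along
the segment is at least that of `b(x₀, ·)`. -/
lemma deriv_deriv_le_of_condB3
    (hb : ContDiffOn ℝ ∞ (Function.uncurry b) (closure X ×ˢ closure Y))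
    (hB1 : CondB1 b X Y) (hB2 : CondB2 b X Y) (hY : IsYmap b X Y Ymap) (hB3 : CondB3 b X Y Ymap)
    {x₀ x : EuclideanSpace ℝ (Fin n)} (hx₀ : closure X ∈ 𝓝 x₀) (hx : closure X ∈ 𝓝 x)
    {y : ℝ → EuclideanSpace ℝ (Fin n)} {t₀ : ℝ} (hy : ContDiffAt ℝ ∞ y t₀)
    (hyY : closure Y ∈ 𝓝 (y t₀)) {a d : EuclideanSpace ℝ (Fin n)}
    (hseg : ∀ᶠ t in 𝓝 t₀, bX b x₀ (y t) = a + t • d) :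
    deriv (deriv fun t => b x₀ (y t)) t₀ ≤ deriv (deriv fun t => b x (y t)) t₀ := by
  obtain ⟨hf, g, hgf, hg⟩ := hB1.2 (y t₀) (mem_of_mem_nhds hyY)
  have hDconv := hB2.2 (y t₀) (mem_of_mem_nhds hyY)
  set D := (fun x => bYd b x (y t₀)) '' closure X with hD
  set q := bYd b x₀ (y t₀) with hq
  set η := bYd b x (y t₀) - q with hη
  set I : Set ℝ := {s | q + s • η ∈ interior D} with hI
  have hIopen : IsOpen I := isOpen_interior.preimage (by fun_prop)
  have hI01 : Icc (0 : ℝ) 1 ⊆ I := by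
    intro s hs
    have h0 : q ∈ interior D :=
      mem_interior_iff_mem_nhds.2 (image_mem_nhds_of_leftInvOn hf hg hgf hx₀)
    have h1 : bYd b x (y t₀) ∈ interior D :=
      mem_interior_iff_mem_nhds.2 (image_mem_nhds_of_leftInvOn hf hg hgf hx)
    exact hDconv.interior.add_smul_sub_mem h0 h1 hs
  set xs : ℝ → EuclideanSpace ℝ (Fin n) := fun s => g (q + s • η) with hxs
  have hxs0 : xs 0 = x₀ := by
    simp only [hxs, zero_smul, add_zero]
    exact hgf (mem_of_mem_nhds hx₀)
  have hxs1 : xs 1 = x := by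
    simp only [hxs, one_smul, hη, add_sub_cancel]
    exact hgf (mem_of_mem_nhds hx)
  have hxsX : ∀ s ∈ I, closure X ∈ 𝓝 (xs s) := fun s hs =>
    mem_nhds_of_leftInvOn hf hg hgf (mem_interior_iff_mem_nhds.1 hs)
  have hxsq : ∀ s ∈ I, bYd b (xs s) (y t₀) = q + s • η := fun s hs =>
    leftInvOn_symm hgf (interior_subset hs)
  have hxss : ∀ s ∈ I, ContDiffAt ℝ ∞ xs s := fun s hs =>
    ContDiffAt.comp s (hg.contDiffAt (mem_interior_iff_mem_nhds.1 hs)) (by fun_prop)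
  set K : ℝ × EuclideanSpace ℝ (Fin n) → ℝ := fun z => b (xs z.1) z.2 with hK
  set U := I ×ˢ interior (closure Y) with hU
  have hUopen : IsOpen U := hIopen.prod isOpen_interior
  have hyint : y t₀ ∈ interior (closure Y) := mem_interior_iff_mem_nhds.2 hyY
  have hKs : ContDiffOn ℝ ∞ K U := by
    rintro ⟨s, y'⟩ ⟨hs, hy'⟩
    refine ContDiffAt.contDiffWithinAt ?_
    refine ContDiffAt.comp (f := fun z : ℝ × EuclideanSpace ℝ (Fin n) => (xs z.1, z.2)) (s, y')
      (contDiffAt_uncurry_of_mem_nhds hb (hxsX s hs) (mem_interior_iff_mem_nhds.1 hy')) ?_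
    exact ((hxss s hs).comp (s, y') contDiffAt_fst).prodMk contDiffAt_snd
  have hDe : EqOn (dirDeriv K (1, 0)) (fun z => ⟪bX b (xs z.1) z.2, deriv xs z.1⟫) U := by
    rintro ⟨s, y'⟩ ⟨hs, hy'⟩
    have h1 := (contDiffAt_left_of_mem_nhds hb (hxsX s hs)
      (mem_interior_iff_mem_nhds.1 hy')).differentiableAt (by simp)
    have h2 := h1.hasFDerivAt.comp_hasDerivAt s
      ((hxss s hs).differentiableAt (by simp)).hasDerivAt
    simp only [bX, inner_gradient_left]
    exact (hasDerivAt_comp_fst hKs hUopen ⟨hs, hy'⟩).unique h2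
  have hDee : ∀ z ∈ U, dirDeriv (dirDeriv K (1, 0)) (1, 0) z =
      ⟪deriv xs z.1, Hxx b (xs z.1) z.2 (deriv xs z.1)⟫ +
        ⟪bX b (xs z.1) z.2, deriv (deriv xs) z.1⟫ := by
    rintro ⟨s, y'⟩ ⟨hs, hy'⟩
    have h1 := (contDiffAt_left_of_mem_nhds hb (hxsX s hs)
      (mem_interior_iff_mem_nhds.1 hy')).gradient.differentiableAt (by simp)
    have h2 := h1.hasFDerivAt.comp_hasDerivAt s
      ((hxss s hs).differentiableAt (by simp)).hasDerivAt
    have h3 : HasDerivAt (deriv xs) (deriv (deriv xs) s) s :=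
      ((((hxss s hs).fderiv_right (m := ∞) (by simp)).clm_apply
        contDiffAt_const).differentiableAt (by simp)).hasDerivAt
    have h4 := h2.inner ℝ h3
    rw [dirDeriv_congr hUopen hDe _ ⟨hs, hy'⟩]
    have h5 := (hasDerivAt_comp_fst ((hKs.dirDeriv hUopen (1, 0)).congr
      fun z hz => (hDe hz).symm) hUopen ⟨hs, hy'⟩).unique h4
    rw [h5, add_comm, real_inner_comm]
    rfl
  have hcont : ∀ᶠ t in 𝓝 t₀, y t ∈ interior (closure Y) :=
    hy.continuousAt.preimage_mem_nhds (isOpen_interior.mem_nhds hyint)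
  have key := deriv_deriv_le_of_cross_curvature hKs hUopen hy
    (fun s hs => ⟨hI01 hs, hyint⟩) ?_ ?_ ?_
  · simpa only [hK, hxs0, hxs1] using key
  · have hev : (fun t => dirDeriv K (1, 0) (0, y t)) =ᶠ[𝓝 t₀]
        fun t => ⟪a + t • d, deriv xs 0⟫ := by
      filter_upwards [hcont, hseg] with t ht hts
      rw [hDe ⟨hI01 (by simp), ht⟩]
      simp only [hxs0, hts]
    rw [hev.deriv.deriv_eq, deriv_deriv_inner_affine]
  · intro s hs
    have hsI := hI01 (Ioo_subset_Icc_self hs)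
    have hsX := mem_of_mem_nhds (hxsX s hsI)
    obtain ⟨hfs, -⟩ := hB1.1 (xs s) hsX
    have hYm := hY.contDiffOn hB1 hsX
    have hYl := hY.leftInvOn hsX
    set C := bX b (xs s) '' closure Y with hC
    have hCmem : C ∈ 𝓝 (bX b (xs s) (y t₀)) := image_mem_nhds_of_leftInvOn hfs hYm hYl hyY
    have hfd := ((hfs.contDiffAt hyY).differentiableAt (by simp)).hasFDerivAt
    set v := fderiv ℝ (fun y => bX b (xs s) y) (y t₀) (deriv y t₀) with hv
    set p : ℝ → EuclideanSpace ℝ (Fin n) := fun r => bX b (xs s) (y t₀) + r • v with hp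
    have hp0 : p 0 = bX b (xs s) (y t₀) := by simp [hp]
    have hpd : HasDerivAt p v 0 := by
      simpa [hp] using ((hasDerivAt_id (0 : ℝ)).smul_const v).const_add (bX b (xs s) (y t₀))
    have hpsm : ContDiffAt ℝ ∞ p 0 := by fun_prop
    have hYp : ContDiffAt ℝ ∞ (Ymap (xs s)) (p 0) := hYm.contDiffAt (by rwa [hp0])
    have hc : ContDiffAt ℝ ∞ (fun r => Ymap (xs s) (p r)) 0 := hYp.comp 0 hpsm
    have hc0 : Ymap (xs s) (p 0) = y t₀ := by rw [hp0]; exact hYl (mem_of_mem_nhds hyY)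
    have hc1 : deriv (fun r => Ymap (xs s) (p r)) 0 = deriv y t₀ := by
      have hYd := (hYp.differentiableAt (by simp)).hasFDerivAt
      have h1 := hYd.comp_hasDerivAt 0 hpd
      rw [hp0] at hYd
      have h2 := (hYd.comp (y t₀) hfd).unique ((hasFDerivAt_id (y t₀)).congr_of_eventuallyEq
        (eventually_of_mem hyY hYl))
      rw [← hp0] at h2
      exact h1.deriv.trans (DFunLike.congr_fun h2 (deriv y t₀))
    refine ⟨_, hc, hc0, hc1, ?_⟩
    have hYint : ∀ {r}, p r ∈ interior C → Ymap (xs s) (p r) ∈ interior (closure Y) := fun hr =>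
      mem_interior_iff_mem_nhds.2 (mem_nhds_of_leftInvOn hfs hYm hYl
        (mem_interior_iff_mem_nhds.1 hr))
    have hconv : ConvexOn ℝ (p ⁻¹' interior C)
        fun r => dirDeriv (dirDeriv K (1, 0)) (1, 0) (s, Ymap (xs s) (p r)) := by
      have hB := (hB3 (xs s) hsX (deriv xs s)).subset interior_subset
        (hB2.1 (xs s) hsX).interior
      have hlin : ConvexOn ℝ (interior C) fun w => ⟪w, deriv (deriv xs) s⟫ := by
        refine ⟨hB.1, fun u _ w _ α β _ _ _ => le_of_eq ?_⟩
        simp [inner_add_left, real_inner_smul_left]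
      have hsum := (hB.add hlin).comp_affineMap
        (AffineMap.lineMap (p 0) (p 0 + v) : ℝ →ᵃ[ℝ] EuclideanSpace ℝ (Fin n))
      have hline : ⇑(AffineMap.lineMap (p 0) (p 0 + v) : ℝ →ᵃ[ℝ] EuclideanSpace ℝ (Fin n)) = p := by
        funext r
        simp [AffineMap.lineMap_apply, hp, add_comm]
      rw [hline] at hsum
      refine hsum.congr fun r hr => ?_
      rw [hDee _ ⟨hsI, hYint hr⟩]
      have : bX b (xs s) (Ymap (xs s) (p r)) = p r := leftInvOn_symm hYl (interior_subset hr)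
      simp [this]
    refine deriv_deriv_nonneg_of_convexOn (hpsm.continuousAt.preimage_mem_nhds
      (interior_mem_nhds.2 (by rwa [hp0]))) hconv ?_
    refine ContDiffAt.comp 0 (((hKs.dirDeriv hUopen _).dirDeriv hUopen _).contDiffAt
      (hUopen.mem_nhds ⟨hsI, ?_⟩)) (contDiffAt_const.prodMk hc)
    change Ymap (xs s) (p 0) ∈ _
    rwa [hc0]
  · intro w
    refine ⟨⟪q, w⟫, ⟪η, w⟫, fun s hs => ?_⟩
    have hsI := hI01 (Ioo_subset_Icc_self hs)
    have hsU : (s, y t₀) ∈ U := ⟨hsI, hyint⟩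
    have hd := ((hKs.contDiffAt (hUopen.mem_nhds hsU)).differentiableAt (by simp)).hasFDerivAt
    have h1 := hd.comp (y t₀) ((hasFDerivAt_const s (y t₀)).prodMk (hasFDerivAt_id (y t₀)))
    have h2 : ⟪bYd b (xs s) (y t₀), w⟫ = dirDeriv K (0, w) (s, y t₀) := by
      rw [bYd, inner_gradient_left]
      have h3 := DFunLike.congr_fun h1.fderiv w
      simpa [dirDeriv, Function.comp_def] using h3
    rw [← h2, hxsq s hsI, inner_add_left, real_inner_smul_left]

lemma CondB1.uniqueDiffOn_left (hB1 : CondB1 b X Y) (hB2 : CondB2 b X Y) (hX : IsOpen X)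
    (hXne : X.Nonempty) (hYne : (closure Y).Nonempty) : UniqueDiffOn ℝ (closure X) := by
  obtain ⟨y, hy⟩ := hYne
  obtain ⟨hf, g, hgf, hg⟩ := hB1.2 y hy
  exact uniqueDiffOn_of_leftInvOn hf hg hgf (hB2.2 y hy)
    (hXne.mono (interior_maximal subset_closure hX))

lemma CondB1.uniqueDiffOn_right (hB1 : CondB1 b X Y) (hB2 : CondB2 b X Y) (hY : IsOpen Y)
    (hYne : Y.Nonempty) (hXne : (closure X).Nonempty) : UniqueDiffOn ℝ (closure Y) := by
  obtain ⟨x, hx⟩ := hXne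
  obtain ⟨hf, g, hgf, hg⟩ := hB1.1 x hx
  exact uniqueDiffOn_of_leftInvOn hf hg hgf (hB2.1 x hx)
    (hYne.mono (interior_maximal subset_closure hY))

/-- By injectivity of `b_x(x, ·)`, the function `b(·, y)` fails to be differentiable at `x` for at
most one `y`, and there `b_x(x, ·)` is determined by continuity; so `b_x` is jointly continuous up
to the boundary. -/
lemma continuousOn_uncurry_bX [Nontrivial (EuclideanSpace ℝ (Fin n))]
    (hX : IsOpen X) (hYopen : IsOpen Y) (hXne : X.Nonempty) (hYne : Y.Nonempty)
    (hb : ContDiffOn ℝ ∞ (Function.uncurry b) (closure X ×ˢ closure Y))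
    (hB1 : CondB1 b X Y) (hB2 : CondB2 b X Y) :
    ContinuousOn (Function.uncurry (bX b)) (closure X ×ˢ closure Y) := by
  have huX := hB1.uniqueDiffOn_left hB2 hX hXne hYne.closure
  have huY := hB1.uniqueDiffOn_right hB2 hYopen hYne hXne.closure
  set S := closure X ×ˢ closure Y with hS
  set φ : EuclideanSpace ℝ (Fin n) × EuclideanSpace ℝ (Fin n) → EuclideanSpace ℝ (Fin n) :=
    fun z => (InnerProductSpace.toDual ℝ _).symm
      ((fderivWithin ℝ (Function.uncurry b) S z).comp (ContinuousLinearMap.inl ℝ _ _)) with hφ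
  have hφc : ContinuousOn φ S :=
    (InnerProductSpace.toDual ℝ (EuclideanSpace ℝ (Fin n))).symm.continuous.comp_continuousOn
      ((hb.continuousOn_fderivWithin (huX.prod huY) (by simp)).clm_comp continuousOn_const)
  refine hφc.congr ?_
  rintro ⟨x, y⟩ ⟨hx, hy⟩
  have hdiff : ∀ {y}, y ∈ closure Y → DifferentiableAt ℝ (fun x' => b x' y) x →
      bX b x y = φ (x, y) := by
    intro y hy hd
    have h1 := ((hb (x, y) ⟨hx, hy⟩).differentiableWithinAt (by simp)).hasFDerivWithinAt
    exact gradient_eq_of_hasFDerivWithinAt hd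
      (HasFDerivWithinAt.comp (f := fun x' => (x', y)) x h1
        (hasFDerivAt_prodMk_left x y).hasFDerivWithinAt fun x' hx' => ⟨hx', hy⟩) (huX x hx)
  change bX b x y = φ (x, y)
  by_cases hd : DifferentiableAt ℝ (fun x' => b x' y) x
  · exact hdiff hy hd
  obtain ⟨hf, g, hgf, -⟩ := hB1.1 x hx
  have hy0 : bX b x y = 0 := gradient_eq_zero_of_not_differentiableAt hd
  have heq : ∀ y' ∈ closure Y \ {y}, bX b x y' = φ (x, y') := by
    rintro y' ⟨hy', hne⟩
    refine hdiff hy' ?_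
    by_contra hd'
    have hy'0 : bX b x y' = 0 := gradient_eq_zero_of_not_differentiableAt hd'
    exact hne (hgf.injOn hy' hy (hy'0.trans hy0.symm))
  have hacc : (𝓝[closure Y \ {y}] y).NeBot :=
    accPt_principal_iff_nhdsWithin.1 (huY y hy).accPt
  have h1 : Tendsto (fun y' => bX b x y') (𝓝[closure Y \ {y}] y) (𝓝 (bX b x y)) :=
    (hf.continuousOn y hy).mono sdiff_subset
  have h2 : Tendsto (fun y' => φ (x, y')) (𝓝[closure Y \ {y}] y) (𝓝 (φ (x, y))) :=
    ((hφc.comp (f := fun y' => (x, y')) (by fun_prop) fun y' hy' => ⟨hx, hy'⟩) y hy).mono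
      sdiff_subset
  exact tendsto_nhds_unique_of_eventuallyEq h1 h2 (eventually_of_mem self_mem_nhdsWithin heq)

lemma tendsto_of_tendsto_bX (hYbdd : Bornology.IsBounded Y) (hB1 : CondB1 b X Y)
    (hcont : ContinuousOn (Function.uncurry (bX b)) (closure X ×ˢ closure Y))
    {ι : Type*} {l : Filter ι} {u w : ι → EuclideanSpace ℝ (Fin n)}
    {x y : EuclideanSpace ℝ (Fin n)} (hx : x ∈ closure X) (hy : y ∈ closure Y)
    (hu : ∀ i, u i ∈ closure X) (hw : ∀ i, w i ∈ closure Y) (hux : Tendsto u l (𝓝 x))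
    (h : Tendsto (fun i => bX b (u i) (w i)) l (𝓝 (bX b x y))) : Tendsto w l (𝓝 y) := by
  obtain ⟨-, g, hgf, -⟩ := hB1.1 x hx
  refine hYbdd.isCompact_closure.tendsto_nhds_of_unique_mapClusterPt (Eventually.of_forall hw)
    fun y' hy' hcl => ?_
  obtain ⟨V, hV, hwV⟩ := mapClusterPt_iff_ultrafilter.1 hcl
  have h1 : Tendsto (fun i => (u i, w i)) V (𝓝[closure X ×ˢ closure Y] (x, y')) :=
    tendsto_nhdsWithin_iff.2 ⟨(hux.mono_left hV).prodMk_nhds hwV,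
      Eventually.of_forall fun i => ⟨hu i, hw i⟩⟩
  have h2 : Tendsto (fun i => bX b (u i) (w i)) V (𝓝 (bX b x y')) :=
    (hcont (x, y') ⟨hx, hy'⟩).tendsto.comp h1
  exact hgf.injOn hy' hy (tendsto_nhds_unique h2 (h.mono_left hV))

/-- The conclusion when all the points involved are interior. -/
lemma convexOn_segment_of_mem_nhds
    (hb : ContDiffOn ℝ ∞ (Function.uncurry b) (closure X ×ˢ closure Y))
    (hB1 : CondB1 b X Y) (hB2 : CondB2 b X Y) (hY : IsYmap b X Y Ymap) (hB3 : CondB3 b X Y Ymap)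
    {x₀ x y₀ y₁ : EuclideanSpace ℝ (Fin n)} (hx₀ : closure X ∈ 𝓝 x₀) (hx : closure X ∈ 𝓝 x)
    (hy₀ : closure Y ∈ 𝓝 y₀) (hy₁ : closure Y ∈ 𝓝 y₁) :
    ConvexOn ℝ (Icc (0 : ℝ) 1) fun t =>
      b x (Ymap x₀ ((1 - t) • bX b x₀ y₀ + t • bX b x₀ y₁)) -
        b x₀ (Ymap x₀ ((1 - t) • bX b x₀ y₀ + t • bX b x₀ y₁)) := by
  have hx₀X := mem_of_mem_nhds hx₀
  obtain ⟨hf, -⟩ := hB1.1 x₀ hx₀X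
  have hYm := hY.contDiffOn hB1 hx₀X
  have hYl := hY.leftInvOn hx₀X
  set C := bX b x₀ '' closure Y with hC
  set p : ℝ → EuclideanSpace ℝ (Fin n) := fun t => (1 - t) • bX b x₀ y₀ + t • bX b x₀ y₁ with hp
  have hps : ContDiff ℝ ∞ p := by fun_prop
  have hpC : ∀ t ∈ Icc (0 : ℝ) 1, p t ∈ interior C := fun t ht =>
    (hB2.1 x₀ hx₀X).interior
      (mem_interior_iff_mem_nhds.2 (image_mem_nhds_of_leftInvOn hf hYm hYl hy₀))
      (mem_interior_iff_mem_nhds.2 (image_mem_nhds_of_leftInvOn hf hYm hYl hy₁))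
      (sub_nonneg.2 ht.2) ht.1 (by ring)
  set y : ℝ → EuclideanSpace ℝ (Fin n) := fun t => Ymap x₀ (p t) with hy
  have hys : ∀ t ∈ Icc (0 : ℝ) 1, ContDiffAt ℝ ∞ y t := fun t ht =>
    (hYm.contDiffAt (mem_interior_iff_mem_nhds.1 (hpC t ht))).comp t hps.contDiffAt
  have hyY : ∀ t ∈ Icc (0 : ℝ) 1, closure Y ∈ 𝓝 (y t) := fun t ht =>
    mem_nhds_of_leftInvOn hf hYm hYl (mem_interior_iff_mem_nhds.1 (hpC t ht))
  have hbs : ∀ {x}, closure X ∈ 𝓝 x → ∀ t ∈ Icc (0 : ℝ) 1, ContDiffAt ℝ ∞ (fun t => b x (y t)) t :=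
    fun hx t ht => (contDiffAt_right_of_mem_nhds hb hx (hyY t ht)).comp t (hys t ht)
  have hderiv : ∀ {f : ℝ → ℝ} {t : ℝ}, ContDiffAt ℝ ∞ f t → DifferentiableAt ℝ (deriv f) t :=
    fun h => ((h.fderiv_right (m := ∞) (by simp)).clm_apply contDiffAt_const).differentiableAt
      (by simp)
  have hsub : ∀ t ∈ Icc (0 : ℝ) 1, ContDiffAt ℝ ∞ (fun t => b x (y t) - b x₀ (y t)) t :=
    fun t ht => (hbs hx t ht).sub (hbs hx₀ t ht)
  refine convexOn_of_deriv2_nonneg' (convex_Icc 0 1)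
    (fun t ht => ((hsub t ht).differentiableAt (by simp)).differentiableWithinAt)
    (fun t ht => (hderiv (hsub t ht)).differentiableWithinAt) fun t ht => ?_
  have hev : deriv (fun t => b x (y t) - b x₀ (y t)) =ᶠ[𝓝 t]
      fun r => deriv (fun t => b x (y t)) r - deriv (fun t => b x₀ (y t)) r := by
    have hone : ∀ {f : ℝ → ℝ}, ContDiffAt ℝ ∞ f t → ∀ᶠ r in 𝓝 t, ContDiffAt ℝ 1 f r :=
      fun h => (h.of_le (by norm_cast)).eventually (by simp)
    filter_upwards [hone (hbs hx t ht), hone (hbs hx₀ t ht)] with r h1 h2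
    exact deriv_fun_sub (h1.differentiableAt one_ne_zero) (h2.differentiableAt one_ne_zero)
  have hseg : ∀ᶠ r in 𝓝 t, bX b x₀ (y r) = bX b x₀ y₀ + r • (bX b x₀ y₁ - bX b x₀ y₀) := by
    filter_upwards [hps.continuous.continuousAt.preimage_mem_nhds
      (isOpen_interior.mem_nhds (hpC t ht))] with r hr
    rw [show bX b x₀ (y r) = p r from leftInvOn_symm hYl (interior_subset hr)]
    simp only [hp]
    module
  have hle := deriv_deriv_le_of_condB3 hb hB1 hB2 hY hB3 hx₀ hx (hys t ht) (hyY t ht) hseg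
  rw [Function.iterate_succ, Function.iterate_one, Function.comp_apply, hev.deriv_eq,
    deriv_fun_sub (hderiv (hbs hx t ht)) (hderiv (hbs hx₀ t ht))]
  exact sub_nonneg.2 hle

lemma convexOn_of_tendsto {ι : Type*} {l : Filter ι} [l.NeBot] {s : Set ℝ} {f : ι → ℝ → ℝ}
    {g : ℝ → ℝ} (hs : Convex ℝ s) (hf : ∀ i, ConvexOn ℝ s (f i))
    (hlim : ∀ t ∈ s, Tendsto (fun i => f i t) l (𝓝 (g t))) : ConvexOn ℝ s g :=
  ⟨hs, fun _ hx _ hy _ _ hα hβ hαβ => le_of_tendsto_of_tendsto' (hlim _ (hs hx hy hα hβ hαβ))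
    (((hlim _ hx).const_mul _).add ((hlim _ hy).const_mul _))
    fun i => (hf i).2 hx hy hα hβ hαβ⟩

lemma convexOn_segment (hX : IsOpen X) (hYopen : IsOpen Y) (hYbdd : Bornology.IsBounded Y)
    (hb : ContDiffOn ℝ ∞ (Function.uncurry b) (closure X ×ˢ closure Y))
    (hB1 : CondB1 b X Y) (hB2 : CondB2 b X Y) (hY : IsYmap b X Y Ymap) (hB3 : CondB3 b X Y Ymap)
    {x₀ x y₀ y₁ : EuclideanSpace ℝ (Fin n)} (hx₀ : x₀ ∈ closure X) (hx : x ∈ closure X)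
    (hy₀ : y₀ ∈ closure Y) (hy₁ : y₁ ∈ closure Y) :
    ConvexOn ℝ (Icc (0 : ℝ) 1) fun t =>
      b x (Ymap x₀ ((1 - t) • bX b x₀ y₀ + t • bX b x₀ y₁)) -
        b x₀ (Ymap x₀ ((1 - t) • bX b x₀ y₀ + t • bX b x₀ y₁)) := by
  rcases subsingleton_or_nontrivial (EuclideanSpace ℝ (Fin n)) with hsub | hnt
  · simpa [Subsingleton.elim x x₀] using convexOn_const (0 : ℝ) (convex_Icc (0 : ℝ) 1)
  have hcont := continuousOn_uncurry_bX hX hYopen (closure_nonempty_iff.1 ⟨x₀, hx₀⟩)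
    (closure_nonempty_iff.1 ⟨y₀, hy₀⟩) hb hB1 hB2
  obtain ⟨u, huX, hu⟩ := mem_closure_iff_seq_limit.1 hx₀
  obtain ⟨v, hvX, hv⟩ := mem_closure_iff_seq_limit.1 hx
  obtain ⟨w₀, hw₀Y, hw₀⟩ := mem_closure_iff_seq_limit.1 hy₀
  obtain ⟨w₁, hw₁Y, hw₁⟩ := mem_closure_iff_seq_limit.1 hy₁
  have hnX : ∀ {z}, z ∈ X → closure X ∈ 𝓝 z := fun hz =>
    mem_of_superset (hX.mem_nhds hz) subset_closure
  have hnY : ∀ {z}, z ∈ Y → closure Y ∈ 𝓝 z := fun hz =>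
    mem_of_superset (hYopen.mem_nhds hz) subset_closure
  refine convexOn_of_tendsto (l := atTop) (convex_Icc 0 1) (fun k =>
    convexOn_segment_of_mem_nhds hb hB1 hB2 hY hB3 (hnX (huX k)) (hnX (hvX k)) (hnY (hw₀Y k))
      (hnY (hw₁Y k))) fun t ht => ?_
  have hpair : ∀ {a c : ℕ → EuclideanSpace ℝ (Fin n)} {a' c' : EuclideanSpace ℝ (Fin n)},
      (∀ k, a k ∈ closure X) → (∀ k, c k ∈ closure Y) → Tendsto a atTop (𝓝 a') →
      Tendsto c atTop (𝓝 c') →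
      Tendsto (fun k => (a k, c k)) atTop (𝓝[closure X ×ˢ closure Y] (a', c')) :=
    fun ha hc h1 h2 => tendsto_nhdsWithin_iff.2
      ⟨h1.prodMk_nhds h2, Eventually.of_forall fun k => ⟨ha k, hc k⟩⟩
  have hseg : ∀ {x y₀ y₁}, x ∈ closure X → y₀ ∈ closure Y → y₁ ∈ closure Y →
      (1 - t) • bX b x y₀ + t • bX b x y₁ ∈ bX b x '' closure Y := fun hx h0 h1 =>
    hB2.1 _ hx (mem_image_of_mem _ h0) (mem_image_of_mem _ h1) (sub_nonneg.2 ht.2) ht.1 (by ring)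
  have huX' := fun k => subset_closure (huX k)
  have hvX' := fun k => subset_closure (hvX k)
  have hw₀Y' := fun k => subset_closure (hw₀Y k)
  have hw₁Y' := fun k => subset_closure (hw₁Y k)
  have hlimit := (hY x₀ hx₀).2 _ (hseg hx₀ hy₀ hy₁)
  have hyk := fun k => (hY (u k) (huX' k)).2 _ (hseg (huX' k) (hw₀Y' k) (hw₁Y' k))
  have hYlim := tendsto_of_tendsto_bX hYbdd hB1 hcont hx₀ hlimit.1 huX' (fun k => (hyk k).1) hu (by
    simp only [hlimit.2, (hyk _).2]
    exact (((hcont (x₀, y₀) ⟨hx₀, hy₀⟩).tendsto.comp (hpair huX' hw₀Y' hu hw₀)).const_smul _).add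
      (((hcont (x₀, y₁) ⟨hx₀, hy₁⟩).tendsto.comp (hpair huX' hw₁Y' hu hw₁)).const_smul _))
  exact ((hb.continuousOn _ ⟨hx, hlimit.1⟩).tendsto.comp
    (hpair hvX' (fun k => (hyk k).1) hv hYlim)).sub
    ((hb.continuousOn _ ⟨hx₀, hlimit.1⟩).tendsto.comp (hpair huX' (fun k => (hyk k).1) hu hYlim))

/-- **Loeper's maximum principle (Theorem 2), strengthened under B3.** If `(y_t)` is the
`b*`-segment joining `y₀` to `y₁` with respect to `x₀`, i.e.
`y_t = Y(x₀, (1−t)b_x(x₀,y₀) + t b_x(x₀,y₁))`, then for each `x ∈ X̄` the function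
`t ↦ b(x,y_t) − b(x₀,y_t)` is convex on `[0,1]`; in particular it is bounded by the
maximum of its endpoint values. -/
theorem loeper_maximum_principle {n : ℕ}
    (X Y : Set (EuclideanSpace ℝ (Fin n)))
    (hXopen : IsOpen X) (hXbdd : Bornology.IsBounded X)
    (hYopen : IsOpen Y) (hYbdd : Bornology.IsBounded Y)
    (b : EuclideanSpace ℝ (Fin n) → EuclideanSpace ℝ (Fin n) → ℝ)
    (hb : ContDiffOn ℝ (⊤ : ℕ∞) (Function.uncurry b) (closure X ×ˢ closure Y))
    (hB1 : CondB1 b X Y) (hB2 : CondB2 b X Y)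
    (Ymap : EuclideanSpace ℝ (Fin n) → EuclideanSpace ℝ (Fin n) → EuclideanSpace ℝ (Fin n))
    (hY : IsYmap b X Y Ymap)
    (hB3 : CondB3 b X Y Ymap)
    (x₀ : EuclideanSpace ℝ (Fin n)) (hx₀ : x₀ ∈ closure X)
    (y₀ y₁ : EuclideanSpace ℝ (Fin n)) (hy₀ : y₀ ∈ closure Y) (hy₁ : y₁ ∈ closure Y)
    (yt : ℝ → EuclideanSpace ℝ (Fin n))
    (hyt : ∀ t ∈ Set.Icc (0:ℝ) 1,
      yt t = Ymap x₀ ((1 - t) • bX b x₀ y₀ + t • bX b x₀ y₁)) :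
    ∀ x ∈ closure X,
      ConvexOn ℝ (Set.Icc (0:ℝ) 1) (fun t => b x (yt t) - b x₀ (yt t)) ∧
      ∀ t ∈ Set.Icc (0:ℝ) 1,
        b x (yt t) - b x₀ (yt t) ≤
          max (b x y₀ - b x₀ y₀) (b x y₁ - b x₀ y₁) := by
  intro x hx
  have hconv : ConvexOn ℝ (Icc (0 : ℝ) 1) (fun t => b x (yt t) - b x₀ (yt t)) :=
    (convexOn_segment hXopen hYopen hYbdd hb hB1 hB2 hY hB3 hx₀ hx hy₀ hy₁).congr fun t ht => by
      simp only [hyt t ht]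
  refine ⟨hconv, fun t ht => ?_⟩
  have h0 : yt 0 = y₀ := by
    simpa [(hY x₀ hx₀).1 y₀ hy₀] using hyt 0 (by simp)
  have h1 : yt 1 = y₁ := by
    simpa [(hY x₀ hx₀).1 y₁ hy₁] using hyt 1 (by simp)
  have := hconv.le_max_of_mem_Icc (by simp) (by simp) ht
  simpa only [h0, h1] using this

end
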